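/- arXiv:2301.12997 — 11 statements merged into one kernel-verified Lean document; each statement's English description precedes it below -/
import Mathlib

section
/- Let M and N be closed subspaces of a complex Hilbert space H, and set M₀ = M ∩ (M ∩ N)^⊥. Define the linear subspaces of H × H: P_{M,N} = {(m + n, m) : m ∈ M, n ∈ N}, E₀ = {(m + n, m) : m ∈ M₀, n ∈ N}, and Z = {(0, z) : z ∈ M ∩ N}. Then P_{M,N} = E₀ + Z, every element of E₀ is orthogonal in H × H to every element of Z (so the sum is direct), and E₀ is single-valued, i.e., (0, y) ∈ E₀ implies y = 0. -/
open scoped InnerProductSpace Pointwise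

/-- For closed subspaces `M`, `N` of a complex Hilbert space `H`, with
`M₀ = M ⊓ (M ⊓ N)ᗮ`, the multivalued projection `P_{M,N}` decomposes as the sum of
`E₀ = {(m + n, m) : m ∈ M₀, n ∈ N}` and `Z = {0} × (M ∩ N)`, the summands are mutually
orthogonal in `H × H`, and `E₀` is single-valued. -/
theorem stmt1 {H : Type*} [NormedAddCommGroup H] [InnerProductSpace ℂ H] [CompleteSpace H]
    (M N : Submodule ℂ H) (hM : IsClosed (M : Set H)) (hN : IsClosed (N : Set H))
    (P E₀ Z : Set (H × H))
    (hP : P = {p : H × H | ∃ m ∈ M, ∃ n ∈ N, p = (m + n, m)})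
    (hE₀ : E₀ = {p : H × H | ∃ m ∈ M ⊓ (M ⊓ N)ᗮ, ∃ n ∈ N, p = (m + n, m)})
    (hZ : Z = {p : H × H | ∃ z ∈ M ⊓ N, p = ((0 : H), z)}) :
    P = E₀ + Z ∧
    (∀ e ∈ E₀, ∀ z ∈ Z, ⟪e.1, z.1⟫_ℂ + ⟪e.2, z.2⟫_ℂ = 0) ∧
    (∀ y : H, ((0 : H), y) ∈ E₀ → y = 0) := by
  subst hP hE₀ hZ
  refine ⟨?_, ?_, ?_⟩
  · ext p
    rw [Set.mem_add]
    constructor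
    · rintro ⟨m, hm, n, hn, rfl⟩
      have hclosed : IsClosed ((M ⊓ N : Submodule ℂ H) : Set H) := hM.inter hN
      have : CompleteSpace (M ⊓ N : Submodule ℂ H) := hclosed.completeSpace_coe
      obtain ⟨z, hz, m₀, hm₀, rfl⟩ := (M ⊓ N).exists_add_mem_mem_orthogonal m
      refine ⟨(m₀ + (z + n), m₀),
        ⟨m₀, ⟨(M.add_mem_iff_right hz.1).1 hm, hm₀⟩, z + n, N.add_mem hz.2 hn, rfl⟩,
        (0, z), ⟨z, hz, rfl⟩, ?_⟩
      ext <;> simp only [Prod.mk_add_mk] <;> abel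
    · rintro ⟨_, ⟨m, hm, n, hn, rfl⟩, _, ⟨z, hz, rfl⟩, rfl⟩
      refine ⟨m + z, M.add_mem hm.1 hz.1, n - z, N.sub_mem hn hz.2, ?_⟩
      ext <;> simp
  · rintro _ ⟨m, hm, n, hn, rfl⟩ _ ⟨z, hz, rfl⟩
    simpa using (Submodule.mem_orthogonal' _ _).1 hm.2 z hz
  · rintro y ⟨m, hm, n, hn, h⟩
    obtain ⟨hsum, rfl⟩ := Prod.mk.inj h
    have hyN : y ∈ N := by
      rw [eq_neg_of_add_eq_zero_left hsum.symm]
      exact N.neg_mem hn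
    exact inner_self_eq_zero.1 ((Submodule.mem_orthogonal' _ _).1 hm.2 y ⟨hm.1, hyN⟩)
end

section
/- Let M and N be linear subspaces of a complex Hilbert space H and let cl(M) denote the closure of M. Then for all u, v ∈ H: (u, v) ∈ P_{M,N} if and only if there exists w ∈ H with (u, w) ∈ P_{cl(M),N} and (w, v) ∈ P_{M, cl(M) ∩ N}. (That is, P_{M,N} equals the composition of the relations P_{cl(M),N} followed by P_{M, cl(M) ∩ N}.) -/
/-- For subspaces `M`, `N` of a complex Hilbert space `H`,
`P_{M,N}` is the composition of `P_{cl M, N}` followed by `P_{M, cl M ∩ N}`: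
`(u, v) ∈ P_{M,N}` iff `∃ w, (u, w) ∈ P_{cl M, N}` and `(w, v) ∈ P_{M, cl M ∩ N}`. -/
theorem stmt5 {H : Type*} [NormedAddCommGroup H] [InnerProductSpace ℂ H] [CompleteSpace H]
    (M N : Submodule ℂ H) :
    ∀ u v : H,
      (∃ m ∈ M, ∃ n ∈ N, (u, v) = (m + n, m)) ↔
      ∃ w : H, (∃ m ∈ M.topologicalClosure, ∃ n ∈ N, (u, w) = (m + n, m)) ∧
        (∃ m ∈ M, ∃ n ∈ M.topologicalClosure ⊓ N, (w, v) = (m + n, m)) := by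
  simp only [Prod.mk.injEq]
  intro u v
  constructor
  · rintro ⟨m, hm, n, hn, rfl, rfl⟩
    exact ⟨v, ⟨v, M.le_topologicalClosure hm, n, hn, rfl, rfl⟩,
      v, hm, 0, zero_mem _, (add_zero v).symm, rfl⟩
  · rintro ⟨w, ⟨_, _, n, hn, rfl, rfl⟩, m, hm, k, hk, rfl, rfl⟩
    exact ⟨v, hm, k + n, N.add_mem hk.2 hn, add_assoc v k n, rfl⟩
end

section
/- Let M and N be linear subspaces of a complex Hilbert space H, let I_M = {(m, m) : m ∈ M} and let x = P_{M,N} ∩ (M^⊥ × H). Then P_{M,N} = I_M + x (sum of linear subspaces of H × H) if and only if N ⊆ M + M^⊥. -/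
open scoped Pointwise

/-- For subspaces `M`, `N` of a complex Hilbert space `H`, with
`I_M = {(m, m) : m ∈ M}` and `x = P_{M,N} ∩ (Mᗮ × H)`, one has
`P_{M,N} = I_M + x` if and only if `N ⊆ M + Mᗮ`. -/
theorem stmt7 {H : Type*} [NormedAddCommGroup H] [InnerProductSpace ℂ H] [CompleteSpace H]
    (M N : Submodule ℂ H) :
    ({p : H × H | ∃ m ∈ M, ∃ n ∈ N, p = (m + n, m)} =
      {p : H × H | ∃ m ∈ M, p = (m, m)} +
      {p : H × H | (∃ m ∈ M, ∃ n ∈ N, p = (m + n, m)) ∧ p.1 ∈ Mᗮ}) ↔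
    N ≤ M ⊔ Mᗮ := by
  constructor
  · intro h n hn
    have hp : ((0 + n, 0) : H × H) ∈ {p : H × H | ∃ m ∈ M, ∃ n ∈ N, p = (m + n, m)} :=
      ⟨0, M.zero_mem, n, hn, rfl⟩
    rw [h] at hp
    obtain ⟨_, ⟨a, ha, rfl⟩, q, ⟨_, hq⟩, hsum⟩ := Set.mem_add.1 hp
    have hfst : a + q.1 = n := by simpa using congrArg Prod.fst hsum
    exact Submodule.mem_sup.2 ⟨a, ha, q.1, hq, hfst⟩
  · intro h
    ext p
    rw [Set.mem_add]
    constructor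
    · rintro ⟨m, hm, n, hn, rfl⟩
      obtain ⟨a, ha, b, hb, rfl⟩ := Submodule.mem_sup.1 (h hn)
      refine ⟨(m + a, m + a), ⟨m + a, M.add_mem hm ha, rfl⟩, (b, -a),
        ⟨⟨-a, M.neg_mem ha, a + b, hn, ?_⟩, hb⟩, ?_⟩
      · rw [neg_add_cancel_left]
      · ext <;> simp [add_assoc]
    · rintro ⟨_, ⟨a, ha, rfl⟩, _, ⟨⟨m, hm, n, hn, rfl⟩, _⟩, rfl⟩
      exact ⟨a + m, M.add_mem ha hm, n, hn, by rw [Prod.mk_add_mk, add_assoc]⟩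
end

section
/- Let M be a linear subspace of a complex Hilbert space H with closure cl(M), let W be a linear subspace of cl(M), and let x be a linear subspace of M^⊥ × cl(M) whose range ran x = {v : ∃u, (u,v) ∈ x} is contained in M. Define E = I_M + (W × {0}) + x (sum of linear subspaces of H × H), where I_M = {(m,m) : m ∈ M} and W × {0} = {(w, 0) : w ∈ W}. Then E = P_{M,N}, where N = {u − v : (u, v) ∈ x} + W. -/
open scoped Pointwise

/-- Let `M` be a subspace of a complex Hilbert space `H`, `W` a subspace of
`cl M`, and `x` a linear subspace of `Mᗮ × cl M` with `ran x ⊆ M`.  Then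
`E = I_M + (W × {0}) + x` equals `P_{M,N}` where `N = {u − v : (u, v) ∈ x} + W`. -/
theorem stmt8 {H : Type*} [NormedAddCommGroup H] [InnerProductSpace ℂ H] [CompleteSpace H]
    (M : Submodule ℂ H) (W : Submodule ℂ H) (hW : W ≤ M.topologicalClosure)
    (x : Submodule ℂ (H × H)) (hx : x ≤ Mᗮ.prod M.topologicalClosure)
    (hran : ∀ p ∈ x, p.2 ∈ M) :
    ({p : H × H | ∃ m ∈ M, p = (m, m)} + {p : H × H | ∃ w ∈ W, p = (w, (0 : H))} +
      (x : Set (H × H))) =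
    {p : H × H | ∃ m ∈ M,
      ∃ n ∈ {h : H | ∃ q ∈ x, ∃ w ∈ W, h = q.1 - q.2 + w}, p = (m + n, m)} := by
  ext p
  constructor
  · rintro ⟨_, ⟨_, ⟨m, hm, rfl⟩, _, ⟨w, hw, rfl⟩, rfl⟩, ⟨u, v⟩, huv, rfl⟩
    refine ⟨m + v, M.add_mem hm (hran _ huv), u - v + w, ⟨(u, v), huv, w, hw, rfl⟩, ?_⟩
    ext
    · change m + w + u = m + v + (u - v + w)
      abel
    · change m + 0 + v = m + v
      abel
  · rintro ⟨m, hm, _, ⟨⟨u, v⟩, huv, w, hw, rfl⟩, rfl⟩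
    refine ⟨_, ⟨_, ⟨m - v, M.sub_mem hm (hran _ huv), rfl⟩, _, ⟨w, hw, rfl⟩, rfl⟩,
      (u, v), huv, ?_⟩
    ext
    · change m - v + w + u = m + (u - v + w)
      abel
    · change m - v + 0 + v = m
      abel
end

section
/- Let M be a linear subspace of a complex Hilbert space H with closure cl(M), let S₁ ⊆ cl(M) and S₂ ⊆ M^⊥ be linear subspaces, and let x be a linear subspace of M^⊥ × cl(M) with ran x ⊆ M. Define the linear subspace of H × H: E = I_M + (N × {0}) + ({0} × (S₁ + S₂)), where N = {u − v : (u,v) ∈ x}. Then E is idempotent, i.e., for all a, c ∈ H one has (a,c) ∈ E if and only if there exists b with (a,b) ∈ E and (b,c) ∈ E, if and only if x(S₂) ⊆ S₁ + mul x, where x(S₂) = {v : ∃u ∈ S₂, (u,v) ∈ x} and mul x = {v : (0,v) ∈ x}. -/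
open scoped Pointwise

/-- Decompositions of a vector along `cl M` and `Mᗮ` are unique. -/
theorem Submodule.eq_and_eq_of_add_eq_add_of_mem_topologicalClosure {H : Type*}
    [NormedAddCommGroup H] [InnerProductSpace ℂ H] {M : Submodule ℂ H} {a b c d : H}
    (ha : a ∈ M.topologicalClosure) (hc : c ∈ M.topologicalClosure)
    (hb : b ∈ Mᗮ) (hd : d ∈ Mᗮ) (h : a + b = c + d) : a = c ∧ b = d := by
  have hdisj : Disjoint M.topologicalClosure Mᗮ := by
    simpa only [Submodule.orthogonal_closure] using M.topologicalClosure.orthogonal_disjoint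
  have hsub : a - c = d - b := by
    rw [sub_eq_sub_iff_add_eq_add, h, add_comm]
  have hac : a - c = 0 := Submodule.disjoint_def.mp hdisj _ (sub_mem ha hc)
    (hsub ▸ sub_mem hd hb)
  exact ⟨sub_eq_zero.mp hac, (sub_eq_zero.mp (hsub.symm.trans hac)).symm⟩

/-- Let `M` be a subspace of a complex Hilbert space `H`, `S₁ ⊆ cl M`,
`S₂ ⊆ Mᗮ` subspaces, and `x` a linear subspace of `Mᗮ × cl M` with `ran x ⊆ M`.
With `N = {u − v : (u,v) ∈ x}`, the relation `E = I_M + (N × {0}) + ({0} × (S₁ + S₂))`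
is idempotent (`E² = E`) if and only if `x(S₂) ⊆ S₁ + mul x`. -/
theorem stmt10 {H : Type*} [NormedAddCommGroup H] [InnerProductSpace ℂ H] [CompleteSpace H]
    (M S₁ S₂ : Submodule ℂ H) (hS₁ : S₁ ≤ M.topologicalClosure) (hS₂ : S₂ ≤ Mᗮ)
    (x : Submodule ℂ (H × H)) (hx : x ≤ Mᗮ.prod M.topologicalClosure)
    (hran : ∀ p ∈ x, p.2 ∈ M)
    (E : Set (H × H))
    (hE : E = {p : H × H | ∃ m ∈ M, p = (m, m)} +
      {p : H × H | ∃ q ∈ x, p = (q.1 - q.2, (0 : H))} +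
      {p : H × H | ∃ s₁ ∈ S₁, ∃ s₂ ∈ S₂, p = ((0 : H), s₁ + s₂)}) :
    (∀ a c : H, (a, c) ∈ E ↔ ∃ b : H, (a, b) ∈ E ∧ (b, c) ∈ E) ↔
    (∀ v : H, (∃ u ∈ S₂, (u, v) ∈ x) →
      ∃ s ∈ S₁, ∃ w : H, ((0 : H), w) ∈ x ∧ v = s + w) := by
  have hmem : ∀ a c : H, (a, c) ∈ E ↔ ∃ m ∈ M, ∃ u v : H, (u, v) ∈ x ∧
      ∃ s₁ ∈ S₁, ∃ s₂ ∈ S₂, a = m + (u - v) ∧ c = m + (s₁ + s₂) := by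
    intro a c
    rw [hE]
    constructor
    · rintro ⟨_, ⟨_, ⟨m, hm, rfl⟩, _, ⟨⟨u, v⟩, hq, rfl⟩, rfl⟩, _, ⟨s₁, h₁, s₂, h₂, rfl⟩, h⟩
      simp only [Prod.mk_add_mk, Prod.mk.injEq, add_zero] at h
      exact ⟨m, hm, u, v, hq, s₁, h₁, s₂, h₂, h.1.symm, h.2.symm⟩
    · rintro ⟨m, hm, u, v, hq, s₁, h₁, s₂, h₂, rfl, rfl⟩
      exact ⟨_, ⟨_, ⟨m, hm, rfl⟩, _, ⟨(u, v), hq, rfl⟩, rfl⟩, _, ⟨s₁, h₁, s₂, h₂, rfl⟩, by simp⟩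
  have hM : M ≤ M.topologicalClosure := M.le_topologicalClosure
  have hzero : ((0 : H), (0 : H)) ∈ x := x.zero_mem
  constructor
  · rintro hidem v ⟨u, hu, huv⟩
    have h0v : ((0 : H), v) ∈ E := (hidem 0 v).mpr ⟨u,
      (hmem _ _).mpr ⟨0, M.zero_mem, 0, 0, hzero, 0, S₁.zero_mem, u, hu, by simp, by simp⟩,
      (hmem _ _).mpr ⟨v, hran _ huv, u, v, huv, 0, S₁.zero_mem, 0, S₂.zero_mem,
        by simp, by simp⟩⟩
    obtain ⟨m, hm, u', v', hx', s₁, h₁, s₂, h₂, ha, hc⟩ := (hmem _ _).mp h0v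
    obtain ⟨rfl, rfl⟩ := Submodule.eq_and_eq_of_add_eq_add_of_mem_topologicalClosure
      (hM hm) (hM (hran _ hx')) (hx hx').1 Mᗮ.zero_mem (by
        rw [add_zero, ← sub_eq_zero, ha]; abel)
    obtain ⟨hv, -⟩ := Submodule.eq_and_eq_of_add_eq_add_of_mem_topologicalClosure
      (hM (hran _ huv)) (add_mem (hM hm) (hS₁ h₁)) Mᗮ.zero_mem (hS₂ h₂)
      (by rw [add_zero, hc, add_assoc])
    exact ⟨s₁, h₁, m, hx', hv.trans (add_comm _ _)⟩
  · intro hS a c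
    constructor
    · rw [hmem]
      rintro ⟨m, hm, u, v, huv, s₁, h₁, s₂, h₂, rfl, rfl⟩
      exact ⟨m,
        (hmem _ _).mpr ⟨m, hm, u, v, huv, 0, S₁.zero_mem, 0, S₂.zero_mem, rfl, by simp⟩,
        (hmem _ _).mpr ⟨m, hm, 0, 0, hzero, s₁, h₁, s₂, h₂, by simp, rfl⟩⟩
    · rintro ⟨b, hab, hbc⟩
      obtain ⟨m, hm, u, v, huv, s₁, h₁, s₂, h₂, rfl, rfl⟩ := (hmem _ _).mp hab
      obtain ⟨m', hm', u', v', huv', t₁, ht₁, t₂, ht₂, hb, rfl⟩ := (hmem _ _).mp hbc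
      obtain ⟨hm_eq, rfl⟩ := Submodule.eq_and_eq_of_add_eq_add_of_mem_topologicalClosure
        (add_mem (hM hm) (hS₁ h₁)) (sub_mem (hM hm') (hM (hran _ huv'))) (hS₂ h₂) (hx huv').1
        (by rw [add_assoc, hb]; abel)
      obtain ⟨s, hs, w, hw, rfl⟩ := hS v' ⟨s₂, h₂, huv'⟩
      refine (hmem _ _).mpr ⟨m + w, add_mem hm (hran _ hw), u, v + w,
        by simpa using add_mem huv hw, s₁ + s + t₁, add_mem (add_mem h₁ hs) ht₁, t₂, ht₂,
        by abel, ?_⟩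
      have heq : m' = m + s₁ + (s + w) := eq_add_of_sub_eq hm_eq.symm
      rw [heq]
      abel
end

section
/- Let W be a bounded selfadjoint operator on a complex Hilbert space H and let S be a linear subspace of H. Then: (1) S + W^{-1}(S^⊥) is dense in H if and only if S^⊥ ∩ cl(W(S)) = {0}, where cl(W(S)) is the closure of the image W(S) = {Ws : s ∈ S}. (2) If S + W^{-1}(S^⊥) = H then S^⊥ ∩ cl(W(S)) = {0} and the subspace S^⊥ + cl(W(S)) is closed; conversely, if S is closed, S^⊥ ∩ cl(W(S)) = {0}, and S^⊥ + cl(W(S)) is closed, then S + W^{-1}(S^⊥) = H. -/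
open scoped InnerProductSpace

/-- If two closed subspaces of a Hilbert space span it, then the sum of their orthogonal
complements is closed. -/
theorem Submodule.isClosed_orthogonal_sup_orthogonal_of_sup_eq_top {H : Type*}
    [NormedAddCommGroup H] [InnerProductSpace ℂ H] [CompleteSpace H] {A B : Submodule ℂ H}
    (hA : IsClosed (A : Set H)) (hB : IsClosed (B : Set H)) (h : A ⊔ B = ⊤) :
    IsClosed ((Aᗮ ⊔ Bᗮ : Submodule ℂ H) : Set H) := by
  have := hA.completeSpace_coe
  have := hB.completeSpace_coe
  obtain ⟨C, hC, hbound⟩ := (A.subtypeL.coprod B.subtypeL).exists_preimage_norm_le (by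
    intro x
    obtain ⟨a, ha, b, hb, rfl⟩ := Submodule.mem_sup.mp (h ▸ Submodule.mem_top : x ∈ A ⊔ B)
    exact ⟨(⟨a, ha⟩, ⟨b, hb⟩), by simp⟩)
  have key : ∀ x ∈ Aᗮ, ∀ y ∈ Bᗮ, ‖x‖ ≤ C * ‖x + y‖ := by
    intro x hx y hy
    obtain ⟨⟨a, b⟩, hab, hn⟩ := hbound x
    have hab' : (a : H) + b = x := by simpa using hab
    have hxx : ⟪(b : H), x + y⟫_ℂ = ⟪x, x⟫_ℂ := by
      rw [inner_add_right, hy b b.2, add_zero]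
      nth_rewrite 2 [← hab']
      rw [inner_add_left, hx a a.2, zero_add]
    have h1 : ‖x‖ * ‖x‖ ≤ (C * ‖x + y‖) * ‖x‖ := by
      calc ‖x‖ * ‖x‖ = ‖⟪x, x⟫_ℂ‖ := by rw [inner_self_eq_norm_sq_to_K]; simp [sq]
        _ ≤ ‖(b : H)‖ * ‖x + y‖ := hxx ▸ norm_inner_le_norm _ _
        _ ≤ (C * ‖x‖) * ‖x + y‖ := by
          gcongr
          exact (norm_snd_le (a, b)).trans hn
        _ = _ := by ring
    rcases (norm_nonneg x).eq_or_lt with h0 | h0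
    · rw [← h0]; positivity
    · exact le_of_mul_le_mul_right h1 h0
  have hanti : AntilipschitzWith (Real.toNNReal (C + 1)) (Aᗮ.subtypeL.coprod Bᗮ.subtypeL) := by
    refine AddMonoidHomClass.antilipschitz_of_bound _ ?_
    rintro ⟨x, y⟩
    have h1 := key x x.2 y y.2
    have h2 : ‖(y : H)‖ ≤ ‖(x : H) + y‖ + ‖(x : H)‖ := by
      simpa using norm_sub_le ((x : H) + y) x
    rw [Real.coe_toNNReal _ (by positivity)]
    simp only [ContinuousLinearMap.coprod_apply, Submodule.subtypeL_apply, Prod.norm_def,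
      Submodule.coe_norm]
    refine max_le ?_ ?_ <;> nlinarith [norm_nonneg ((x : H) + y)]
  have hcl := hanti.isClosed_range (Aᗮ.subtypeL.coprod Bᗮ.subtypeL).uniformContinuous
  convert hcl using 1
  ext z
  simp [Submodule.mem_sup]

/-- If two closed subspaces of a Hilbert space meet trivially and have closed sum, then their
orthogonal complements span the space. -/
theorem Submodule.orthogonal_sup_orthogonal_eq_top_of_isClosed_sup {H : Type*}
    [NormedAddCommGroup H] [InnerProductSpace ℂ H] [CompleteSpace H] {A B : Submodule ℂ H}
    (hA : IsClosed (A : Set H)) (hB : IsClosed (B : Set H)) (hAB : A ⊓ B = ⊥)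
    (h : IsClosed ((A ⊔ B : Submodule ℂ H) : Set H)) : Aᗮ ⊔ Bᗮ = ⊤ := by
  have := hA.completeSpace_coe
  have := hB.completeSpace_coe
  let T : A × B →L[ℂ] H := A.subtypeL.coprod B.subtypeL
  have hT : ∀ p, T p = (p.1 : H) + p.2 := fun p => by simp [T]
  have hinj : Function.Injective T := by
    rw [injective_iff_map_eq_zero]
    rintro ⟨a, b⟩ hab
    have hab' : (a : H) + b = 0 := (hT _).symm.trans hab
    have ha : (a : H) ∈ A ⊓ B :=
      ⟨a.2, by rw [eq_neg_of_add_eq_zero_left hab']; exact B.neg_mem b.2⟩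
    rw [hAB, Submodule.mem_bot] at ha
    have hb : (b : H) = 0 := by simpa [ha] using hab'
    exact Prod.ext (Subtype.ext ha) (Subtype.ext hb)
  have hcl : IsClosed (Set.range T) := by
    convert h using 1
    ext z
    simp [Submodule.mem_sup, hT]
  rw [eq_top_iff]
  intro x _
  obtain ⟨g, hg, -⟩ := exists_extension_norm_eq T.range
    (innerSL ℂ x ∘L A.subtypeL ∘L ContinuousLinearMap.fst ℂ A B ∘L
      ((T.equivRange hinj hcl).symm : T.range →L[ℂ] A × B))
  have hgT : ∀ p, g (T p) = ⟪x, (p.1 : H)⟫_ℂ := fun p => by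
    simpa [T.equivRange_symm_apply hinj hcl p] using hg ⟨T p, by simp⟩
  let z : H := (InnerProductSpace.toDual ℂ H).symm g
  have hz : ∀ p : A × B, ⟪z, (p.1 : H) + p.2⟫_ℂ = ⟪x, (p.1 : H)⟫_ℂ := fun p => by
    rw [← hgT, hT, InnerProductSpace.toDual_symm_apply]
  refine Submodule.mem_sup.mpr ⟨x - z, ?_, z, ?_, sub_add_cancel x z⟩
  · rw [Submodule.mem_orthogonal']
    intro a ha
    have := hz (⟨a, ha⟩, 0)
    simp only [ZeroMemClass.coe_zero, add_zero] at this
    rw [inner_sub_left, this, sub_self]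
  · rw [Submodule.mem_orthogonal']
    intro b hb
    simpa using hz (0, ⟨b, hb⟩)

/-- The preimage of `Sᗮ` under a selfadjoint operator is the orthogonal complement of the image
of `S`. -/
theorem IsSelfAdjoint.comap_orthogonal {H : Type*}
    [NormedAddCommGroup H] [InnerProductSpace ℂ H] [CompleteSpace H] {W : H →L[ℂ] H}
    (hW : IsSelfAdjoint W) (S : Submodule ℂ H) :
    Sᗮ.comap (W : H →ₗ[ℂ] H) = (S.map (W : H →ₗ[ℂ] H))ᗮ := by
  ext x
  simp only [Submodule.mem_comap, Submodule.mem_orthogonal, Submodule.mem_map,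
    forall_exists_index, and_imp, forall_apply_eq_imp_iff₂]
  exact forall₂_congr fun s _ => by
    rw [show ⟪(W : H →ₗ[ℂ] H) s, x⟫_ℂ = ⟪s, (W : H →ₗ[ℂ] H) x⟫_ℂ from hW.isSymmetric s x]


/-- Let `W` be a bounded selfadjoint operator on a complex Hilbert space
`H` and `S` a subspace.  (1) `S + W⁻¹(Sᗮ)` is dense iff `Sᗮ ∩ cl(W(S)) = {0}`.
(2) If `S + W⁻¹(Sᗮ) = H` then `Sᗮ ∩ cl(W(S)) = {0}` and `Sᗮ + cl(W(S))` is closed;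
conversely, if `S` is closed, `Sᗮ ∩ cl(W(S)) = {0}` and `Sᗮ + cl(W(S))` is closed,
then `S + W⁻¹(Sᗮ) = H`. -/
theorem stmt12 {H : Type*} [NormedAddCommGroup H] [InnerProductSpace ℂ H] [CompleteSpace H]
    (W : H →L[ℂ] H) (hW : IsSelfAdjoint W) (S : Submodule ℂ H) :
    (Dense ((S ⊔ Sᗮ.comap (W : H →ₗ[ℂ] H) : Submodule ℂ H) : Set H) ↔
      Sᗮ ⊓ (S.map (W : H →ₗ[ℂ] H)).topologicalClosure = ⊥) ∧
    (S ⊔ Sᗮ.comap (W : H →ₗ[ℂ] H) = ⊤ →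
      Sᗮ ⊓ (S.map (W : H →ₗ[ℂ] H)).topologicalClosure = ⊥ ∧
      IsClosed ((Sᗮ ⊔ (S.map (W : H →ₗ[ℂ] H)).topologicalClosure : Submodule ℂ H) : Set H)) ∧
    (IsClosed (S : Set H) →
      Sᗮ ⊓ (S.map (W : H →ₗ[ℂ] H)).topologicalClosure = ⊥ →
      IsClosed ((Sᗮ ⊔ (S.map (W : H →ₗ[ℂ] H)).topologicalClosure : Submodule ℂ H) : Set H) →
      S ⊔ Sᗮ.comap (W : H →ₗ[ℂ] H) = ⊤) := by
  rw [hW.comap_orthogonal S]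
  set N := S.map (W : H →ₗ[ℂ] H)
  have hdense : Dense ((S ⊔ Nᗮ : Submodule ℂ H) : Set H) ↔ Sᗮ ⊓ N.topologicalClosure = ⊥ := by
    rw [Submodule.dense_iff_topologicalClosure_eq_top, Submodule.topologicalClosure_eq_top_iff,
      ← Submodule.inf_orthogonal, Submodule.orthogonal_orthogonal_eq_closure]
  refine ⟨hdense, fun h => ⟨hdense.mp ?_, ?_⟩, fun hS hbot hcl => ?_⟩
  · rw [h]
    exact dense_univ
  · have htop : S.topologicalClosure ⊔ Nᗮ = ⊤ :=
      top_le_iff.mp (h ▸ sup_le_sup_right S.le_topologicalClosure _)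
    have := Submodule.isClosed_orthogonal_sup_orthogonal_of_sup_eq_top
      S.isClosed_topologicalClosure N.isClosed_orthogonal htop
    rwa [Submodule.orthogonal_closure, Submodule.orthogonal_orthogonal_eq_closure] at this
  · have := Submodule.orthogonal_sup_orthogonal_eq_top_of_isClosed_sup
      S.isClosed_orthogonal N.isClosed_topologicalClosure hbot hcl
    rwa [Submodule.orthogonal_closure, Submodule.orthogonal_orthogonal_eq_closure,
      hS.submodule_topologicalClosure_eq] at this
end

section
/- Let W be a positive bounded operator on a complex Hilbert space H with positive square root W^{1/2} (the unique positive bounded operator R with R² = W), and let S be a linear subspace of H such that S + W^{-1}(S^⊥) = H. Then: (a) there exists a bounded linear operator T on H such that T(s + n) = W^{1/2} s for all s ∈ S and n ∈ W^{-1}(S^⊥) (in particular this assignment is well defined); (b) there exists a positive bounded linear operator Q on H such that Q(s + n) = W s for all s ∈ S and n ∈ W^{-1}(S^⊥). -/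
/-- Elements `R s` with `s ∈ S` and `R n` with `n ∈ (R²)⁻¹(Sᗮ)` are separated by the orthogonal
projection onto the closure of `R(S)`. -/
theorem starProjection_closure_map_apply_add {H : Type*} [NormedAddCommGroup H]
    [InnerProductSpace ℂ H] [CompleteSpace H] {R : H →L[ℂ] H} (hR : R.IsPositive)
    {S : Submodule ℂ H} {s n : H} (hs : s ∈ S) (hn : R (R n) ∈ Sᗮ) :
    (S.map (R : H →ₗ[ℂ] H)).topologicalClosure.starProjection (R (s + n)) = R s := by
  have hs' : R s ∈ (S.map (R : H →ₗ[ℂ] H)).topologicalClosure :=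
    Submodule.le_topologicalClosure _ (Submodule.mem_map_of_mem hs)
  have hn' : R n ∈ (S.map (R : H →ₗ[ℂ] H)).topologicalClosureᗮ := by
    rw [Submodule.orthogonal_closure, Submodule.mem_orthogonal]
    rintro _ ⟨t, ht, rfl⟩
    exact (hR.isSymmetric t (R n)).trans ((Submodule.mem_orthogonal _ _).1 hn t ht)
  rw [map_add, map_add, Submodule.starProjection_eq_self_iff.2 hs',
    (Submodule.starProjection_apply_eq_zero_iff _).2 hn', add_zero]


/-- Let `W` be a positive bounded operator on a complex Hilbert space `H`
with positive square root `R = W^{1/2}`, and `S` a subspace with `S + W⁻¹(Sᗮ) = H`.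
Then (a) there is a bounded operator `T` with `T (s + n) = R s` for all `s ∈ S`,
`n ∈ W⁻¹(Sᗮ)`; (b) there is a positive bounded operator `Q` with `Q (s + n) = W s`
for all such `s, n`. -/
theorem stmt14 {H : Type*} [NormedAddCommGroup H] [InnerProductSpace ℂ H] [CompleteSpace H]
    (W R : H →L[ℂ] H) (hW : W.IsPositive) (hR : R.IsPositive) (hR2 : R ∘L R = W)
    (S : Submodule ℂ H)
    (hcomp : S ⊔ Sᗮ.comap (W : H →ₗ[ℂ] H) = ⊤) :
    (∃ T : H →L[ℂ] H, ∀ s ∈ S, ∀ n ∈ Sᗮ.comap (W : H →ₗ[ℂ] H), T (s + n) = R s) ∧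
    (∃ Q : H →L[ℂ] H, Q.IsPositive ∧
      ∀ s ∈ S, ∀ n ∈ Sᗮ.comap (W : H →ₗ[ℂ] H), Q (s + n) = W s) := by
  subst hR2
  set P := (S.map (R : H →ₗ[ℂ] H)).topologicalClosure.starProjection
  have key : ∀ s ∈ S, ∀ n ∈ Sᗮ.comap ((R ∘L R : H →L[ℂ] H) : H →ₗ[ℂ] H),
      P (R (s + n)) = R s :=
    fun s hs n hn => starProjection_closure_map_apply_add hR hs hn
  refine ⟨⟨P ∘L R, key⟩, R ∘L P ∘L R, ?_, fun s hs n hn => congrArg R (key s hs n hn)⟩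
  have hP : P.IsPositive := ContinuousLinearMap.IsPositive.of_isStarProjection
    isStarProjection_starProjection
  simpa only [hR.isSelfAdjoint.adjoint_eq] using hP.conj_adjoint R
end

section
/- Let A be a linear relation on a complex Hilbert space H (a linear subspace of H × H), let W be a positive bounded operator on H with positive square root W^{1/2}, and let b ∈ H. Then there exists a W-least squares solution of the inclusion b ∈ Ax — that is, there exist x₀, z with (x₀, z) ∈ A and ‖W^{1/2}(z − b)‖ ≤ ‖W^{1/2}(y − b)‖ for every y ∈ ran A — if and only if b ∈ ran A + W^{-1}((ran A)^⊥). Consequently, a W-least squares solution exists for every b ∈ H if and only if ran A + W^{-1}((ran A)^⊥) = H. -/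
/-- A vector `v` of a subspace `K` minimizes the distance to `u` over `K` iff `u - v ⟂ K`. -/
theorem Submodule.forall_norm_sub_le_iff_inner_eq_zero {𝕜 E : Type*} [RCLike 𝕜]
    [NormedAddCommGroup E] [InnerProductSpace 𝕜 E] (K : Submodule 𝕜 E) {u v : E} (hv : v ∈ K) :
    (∀ w ∈ K, ‖u - v‖ ≤ ‖u - w‖) ↔ ∀ w ∈ K, inner 𝕜 (u - v) w = 0 := by
  rw [← K.norm_eq_iInf_iff_inner_eq_zero hv]
  have hbdd : BddBelow (Set.range fun w : K => ‖u - w‖) :=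
    ⟨0, by rintro _ ⟨w, rfl⟩; exact norm_nonneg _⟩
  constructor
  · intro h
    exact le_antisymm (le_ciInf fun w => h w w.2) (ciInf_le hbdd ⟨v, hv⟩)
  · intro h w hw
    exact h.trans_le (ciInf_le hbdd ⟨w, hw⟩)

/-- The normal equation: `z ∈ K` minimizes `‖R (y - b)‖` over `y ∈ K` iff
`R² (b - z)` is orthogonal to `K`, for `R` symmetric. -/
theorem LinearMap.IsSymmetric.forall_norm_map_sub_le_iff {𝕜 E : Type*} [RCLike 𝕜]
    [NormedAddCommGroup E] [InnerProductSpace 𝕜 E] {R : E →ₗ[𝕜] E} (hR : R.IsSymmetric)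
    (K : Submodule 𝕜 E) {b z : E} (hz : z ∈ K) :
    (∀ y ∈ K, ‖R (z - b)‖ ≤ ‖R (y - b)‖) ↔ R (R (b - z)) ∈ Kᗮ := by
  have h := (K.map R).forall_norm_sub_le_iff_inner_eq_zero (u := R b)
    (Submodule.mem_map_of_mem hz)
  simp only [Submodule.mem_map, forall_exists_index, and_imp, forall_apply_eq_imp_iff₂,
    ← map_sub] at h
  simp only [Submodule.mem_orthogonal', hR (R _), ← h]
  simp only [map_sub, norm_sub_rev _ (R b)]


/-- Let `A` be a linear relation on a complex Hilbert space `H`, `W` a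
positive bounded operator with positive square root `R = W^{1/2}`, and `b ∈ H`.  A
`W`-least squares solution of the inclusion `b ∈ Ax` exists iff
`b ∈ ran A + W⁻¹((ran A)ᗮ)`; consequently one exists for every `b` iff
`ran A + W⁻¹((ran A)ᗮ) = H`. -/
theorem stmt15 {H : Type*} [NormedAddCommGroup H] [InnerProductSpace ℂ H] [CompleteSpace H]
    (A : Submodule ℂ (H × H)) (W R : H →L[ℂ] H)
    (hW : W.IsPositive) (hR : R.IsPositive) (hR2 : R ∘L R = W) :
    (∀ b : H,
      (∃ x₀ z : H, (x₀, z) ∈ A ∧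
          ∀ y ∈ A.map (LinearMap.snd ℂ H H), ‖R (z - b)‖ ≤ ‖R (y - b)‖) ↔
        b ∈ A.map (LinearMap.snd ℂ H H) ⊔
          (A.map (LinearMap.snd ℂ H H))ᗮ.comap (W : H →ₗ[ℂ] H)) ∧
    ((∀ b : H, ∃ x₀ z : H, (x₀, z) ∈ A ∧
          ∀ y ∈ A.map (LinearMap.snd ℂ H H), ‖R (z - b)‖ ≤ ‖R (y - b)‖) ↔
      A.map (LinearMap.snd ℂ H H) ⊔
        (A.map (LinearMap.snd ℂ H H))ᗮ.comap (W : H →ₗ[ℂ] H) = ⊤) := by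
  have hiff : ∀ b : H,
      (∃ x₀ z : H, (x₀, z) ∈ A ∧
          ∀ y ∈ A.map (LinearMap.snd ℂ H H), ‖R (z - b)‖ ≤ ‖R (y - b)‖) ↔
        b ∈ A.map (LinearMap.snd ℂ H H) ⊔
          (A.map (LinearMap.snd ℂ H H))ᗮ.comap (W : H →ₗ[ℂ] H) := by
    intro b
    have key {z : H} (hz : z ∈ A.map (LinearMap.snd ℂ H H)) :
        (∀ y ∈ A.map (LinearMap.snd ℂ H H), ‖R (z - b)‖ ≤ ‖R (y - b)‖) ↔
          W (b - z) ∈ (A.map (LinearMap.snd ℂ H H))ᗮ := by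
      rw [← hR2]
      exact hR.isSymmetric.forall_norm_map_sub_le_iff _ hz
    rw [Submodule.mem_sup]
    constructor
    · rintro ⟨x₀, z, hxz, hmin⟩
      have hz : z ∈ A.map (LinearMap.snd ℂ H H) := ⟨(x₀, z), hxz, rfl⟩
      exact ⟨z, hz, b - z, (key hz).1 hmin, add_sub_cancel z b⟩
    · rintro ⟨z, hz, w, hw, rfl⟩
      obtain ⟨⟨x₀, z'⟩, hxz, rfl⟩ := id hz
      exact ⟨x₀, z', hxz, (key hz).2 (by simpa using hw)⟩
  exact ⟨hiff, by simp only [hiff, Submodule.eq_top_iff']⟩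
end

section
/- Let W be a positive bounded operator on a complex Hilbert space H with positive square root W^{1/2}, let S be a linear subspace of H, and let b = s₀ + n₀ with s₀ ∈ S and n₀ ∈ W^{-1}(S^⊥). Then for every y ∈ S one has ‖W^{1/2}(y − b)‖ ≥ ‖W^{1/2} n₀‖, with equality attained at y = s₀; moreover, for y ∈ S the equality ‖W^{1/2}(y − b)‖ = ‖W^{1/2} n₀‖ holds if and only if b − y ∈ W^{-1}(S^⊥). -/
/-- A positive `R` satisfies `⟪R x, R y⟫ = ⟪x, R² y⟫`. -/
theorem inner_map_map_of_isPositive {H : Type*} [NormedAddCommGroup H] [InnerProductSpace ℂ H]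
    [CompleteSpace H] {R : H →L[ℂ] H} (hR : R.IsPositive) (x y : H) :
    inner ℂ (R x) (R y) = inner ℂ x ((R ∘L R) y) :=
  hR.isSymmetric x (R y)

/-- Let `W` be a positive bounded operator on a complex Hilbert space `H`
with positive square root `R = W^{1/2}`, `S` a subspace, and `b = s₀ + n₀` with
`s₀ ∈ S`, `n₀ ∈ W⁻¹(Sᗮ)`.  Then `‖R (y − b)‖ ≥ ‖R n₀‖` for every `y ∈ S`, equality
holds at `y = s₀`, and for `y ∈ S` equality holds iff `b − y ∈ W⁻¹(Sᗮ)`. -/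
theorem stmt16 {H : Type*} [NormedAddCommGroup H] [InnerProductSpace ℂ H] [CompleteSpace H]
    (W R : H →L[ℂ] H) (hW : W.IsPositive) (hR : R.IsPositive) (hR2 : R ∘L R = W)
    (S : Submodule ℂ H) (b s₀ n₀ : H)
    (hs₀ : s₀ ∈ S) (hn₀ : W n₀ ∈ Sᗮ) (hb : b = s₀ + n₀) :
    (∀ y ∈ S, ‖R n₀‖ ≤ ‖R (y - b)‖) ∧
    ‖R (s₀ - b)‖ = ‖R n₀‖ ∧
    (∀ y ∈ S, (‖R (y - b)‖ = ‖R n₀‖ ↔ W (b - y) ∈ Sᗮ)) := by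
  subst hb hR2
  have hpyth (y : H) (hy : y ∈ S) :
      ‖R (y - (s₀ + n₀))‖ * ‖R (y - (s₀ + n₀))‖ =
        ‖R (y - s₀)‖ * ‖R (y - s₀)‖ + ‖R n₀‖ * ‖R n₀‖ := by
    have horth : inner ℂ (R (y - s₀)) (R n₀) = 0 := by
      rw [inner_map_map_of_isPositive hR]
      exact (Submodule.mem_orthogonal S _).1 hn₀ _ (S.sub_mem hy hs₀)
    rw [← sub_sub, map_sub R (y - s₀) n₀, sub_eq_add_neg (R (y - s₀)),
      norm_add_sq_eq_norm_sq_add_norm_sq_of_inner_eq_zero (𝕜 := ℂ) _ _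
        (by rw [inner_neg_right, horth, neg_zero]), norm_neg]
  refine ⟨fun y hy => ?_, by simp, fun y hy => ?_⟩
  · refine (mul_self_le_mul_self_iff (norm_nonneg _) (norm_nonneg _)).2 ?_
    linarith [hpyth y hy, mul_self_nonneg ‖R (y - s₀)‖]
  · have hsplit : s₀ + n₀ - y = n₀ - (y - s₀) := by abel
    constructor
    · intro h
      have hzero : R (y - s₀) = 0 := by
        have := hpyth y hy
        rw [h, right_eq_add, mul_self_eq_zero, norm_eq_zero] at this
        exact this
      rw [hsplit, map_sub, ContinuousLinearMap.comp_apply R R (y - s₀), hzero, map_zero, sub_zero]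
      exact hn₀
    · intro h
      have hmem : (R ∘L R) (y - s₀) ∈ Sᗮ := by
        have := Sᗮ.sub_mem hn₀ h
        rwa [hsplit, map_sub, sub_sub_cancel] at this
      have hzero : R (y - s₀) = 0 := by
        rw [← inner_self_eq_zero (𝕜 := ℂ), inner_map_map_of_isPositive hR]
        exact (Submodule.mem_orthogonal S _).1 hmem _ (S.sub_mem hy hs₀)
      rw [← sub_sub, map_sub, hzero, zero_sub, norm_neg]
end

section
/- Let A be a linear relation on a complex Hilbert space H, let W be a positive bounded operator on H with positive square root W^{1/2}, and let b ∈ ran A + W^{-1}((ran A)^⊥). Then for x₀ ∈ H the following are equivalent: (1) x₀ is a W-least squares solution of the inclusion b ∈ Ax, i.e. there exists z with (x₀, z) ∈ A and ‖W^{1/2}(z − b)‖ ≤ ‖W^{1/2}(y − b)‖ for all y ∈ ran A; (2) there exists z with (x₀, z) ∈ A and W(z − b) ∈ (ran A)^⊥. -/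
/-- Pythagoras for the seminorm `‖R ·‖`, where `R` is selfadjoint and `R²c ∈ Mᗮ`. -/
theorem norm_map_add_mul_self_of_mem_orthogonal {H : Type*} [NormedAddCommGroup H]
    [InnerProductSpace ℂ H] {R : H →L[ℂ] H} (hR : (R : H →ₗ[ℂ] H).IsSymmetric)
    {M : Submodule ℂ H} {u c : H} (hu : u ∈ M) (hc : R (R c) ∈ Mᗮ) :
    ‖R (u + c)‖ * ‖R (u + c)‖ = ‖R u‖ * ‖R u‖ + ‖R c‖ * ‖R c‖ := by
  rw [map_add]
  refine norm_add_sq_eq_norm_sq_add_norm_sq_of_inner_eq_zero (𝕜 := ℂ) _ _ ?_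
  exact (hR u (R c)).trans (hc u hu)

/-- Let `A` be a linear relation on a complex Hilbert space `H`, `W` a
positive bounded operator with positive square root `R = W^{1/2}`, and
`b ∈ ran A + W⁻¹((ran A)ᗮ)`.  Then `x₀` is a `W`-least squares solution of `b ∈ Ax`
iff there is `z` with `(x₀, z) ∈ A` and `W (z − b) ∈ (ran A)ᗮ`. -/
theorem stmt17 {H : Type*} [NormedAddCommGroup H] [InnerProductSpace ℂ H] [CompleteSpace H]
    (A : Submodule ℂ (H × H)) (W R : H →L[ℂ] H)
    (hW : W.IsPositive) (hR : R.IsPositive) (hR2 : R ∘L R = W) (b : H)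
    (hb : b ∈ A.map (LinearMap.snd ℂ H H) ⊔
      (A.map (LinearMap.snd ℂ H H))ᗮ.comap (W : H →ₗ[ℂ] H))
    (x₀ : H) :
    (∃ z : H, (x₀, z) ∈ A ∧
        ∀ y ∈ A.map (LinearMap.snd ℂ H H), ‖R (z - b)‖ ≤ ‖R (y - b)‖) ↔
    (∃ z : H, (x₀, z) ∈ A ∧ W (z - b) ∈ (A.map (LinearMap.snd ℂ H H))ᗮ) := by
  have hsymm := hR.isSymmetric
  subst hR2
  refine exists_congr fun z => and_congr_right fun hz => ?_
  have hzM : z ∈ A.map (LinearMap.snd ℂ H H) := ⟨(x₀, z), hz, rfl⟩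
  constructor
  · intro hmin
    obtain ⟨m, hm, c, hc, rfl⟩ := Submodule.mem_sup.1 hb
    have hpyth := norm_map_add_mul_self_of_mem_orthogonal hsymm
      (Submodule.sub_mem _ hzM hm) (c := -c)
      (by rw [map_neg, map_neg]; exact Submodule.neg_mem _ hc)
    have hle := hmin m hm
    rw [show z - (m + c) = z - m + -c by abel, show m - (m + c) = -c by abel] at hle
    have hzero : R (z - m) = 0 := by
      have hsq := mul_self_le_mul_self (norm_nonneg _) hle
      exact norm_eq_zero.1 (mul_self_eq_zero.1
        (le_antisymm (by linarith) (mul_self_nonneg _)))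
    rw [show z - (m + c) = z - m + -c by abel, map_add, ContinuousLinearMap.comp_apply, hzero,
      map_zero, zero_add, map_neg]
    exact Submodule.neg_mem _ hc
  · intro horth y hy
    have hpyth := norm_map_add_mul_self_of_mem_orthogonal hsymm
      (Submodule.sub_mem _ hy hzM) horth
    rw [sub_add_sub_cancel] at hpyth
    exact (mul_self_le_mul_self_iff (norm_nonneg _) (norm_nonneg _)).2
      (by linarith [mul_self_nonneg ‖R (y - z)‖])
end

section
/- Let A be a linear relation on a complex Hilbert space H, let W be a positive bounded operator on H with positive square root W^{1/2}, let b ∈ ran A + W^{-1}((ran A)^⊥), and suppose x₀ is a W-least squares solution of the inclusion b ∈ Ax. Then for any x₁ ∈ H, x₁ is a W-least squares solution of b ∈ Ax if and only if there exists y ∈ H with (x₁ − x₀, y) ∈ A and Wy = 0. That is, the set of W-least squares solutions equals x₀ + A^{-1}(ker W), where A^{-1}(ker W) = {u : ∃y ∈ ker W, (u, y) ∈ A}. -/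
/-- Two elements of a subspace `S` that both minimize `y ↦ ‖R (y - b)‖` over `S`
have the same image under `R`. -/
theorem map_eq_of_forall_norm_le {H : Type*} [NormedAddCommGroup H] [InnerProductSpace ℂ H]
    (S : Submodule ℂ H) (R : H →L[ℂ] H) {b z w : H} (hzS : z ∈ S) (hwS : w ∈ S)
    (hz : ∀ y ∈ S, ‖R (z - b)‖ ≤ ‖R (y - b)‖) (hw : ∀ y ∈ S, ‖R (w - b)‖ ≤ ‖R (y - b)‖) :
    R z = R w := by
  have heq : ‖R (z - b)‖ = ‖R (w - b)‖ := le_antisymm (hz w hwS) (hw z hzS)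
  have hmid := hz ((2⁻¹ : ℂ) • (z + w)) (S.smul_mem _ (S.add_mem hzS hwS))
  have hsum : (2⁻¹ : ℂ) • (z + w) - b = (2⁻¹ : ℂ) • ((z - b) + (w - b)) := by module
  rw [hsum, map_smul, map_add, norm_smul, norm_inv, Complex.norm_two] at hmid
  have hpar := parallelogram_law_with_norm ℂ (R (z - b)) (R (w - b))
  have hdiff : R (z - b) - R (w - b) = R z - R w := by simp
  rw [hdiff, ← heq] at hpar
  have hzero : ‖R z - R w‖ = 0 := by
    nlinarith [norm_nonneg (R (z - b)), norm_nonneg (R z - R w)]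
  exact sub_eq_zero.mp (norm_eq_zero.mp hzero)

/-- The square of a symmetric operator has the same kernel as the operator. -/
theorem apply_eq_zero_of_isSymmetric_of_apply_apply_eq_zero {H : Type*} [NormedAddCommGroup H]
    [InnerProductSpace ℂ H] {R : H →L[ℂ] H} (hR : (R : H →ₗ[ℂ] H).IsSymmetric) {y : H}
    (h : R (R y) = 0) : R y = 0 := by
  have hinner : inner ℂ (R y) (R y) = inner ℂ (R (R y)) y := (hR (R y) y).symm
  rwa [h, inner_zero_left, inner_self_eq_zero] at hinner


/-- Let `A` be a linear relation on a complex Hilbert space `H`, `W` a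
positive bounded operator with positive square root `R = W^{1/2}`,
`b ∈ ran A + W⁻¹((ran A)ᗮ)`, and `x₀` a `W`-least squares solution of `b ∈ Ax`.
Then `x₁` is a `W`-least squares solution of `b ∈ Ax` iff there is `y` with
`(x₁ − x₀, y) ∈ A` and `W y = 0`; i.e. the solution set is `x₀ + A⁻¹(ker W)`. -/
theorem stmt18 {H : Type*} [NormedAddCommGroup H] [InnerProductSpace ℂ H] [CompleteSpace H]
    (A : Submodule ℂ (H × H)) (W R : H →L[ℂ] H)
    (hW : W.IsPositive) (hR : R.IsPositive) (hR2 : R ∘L R = W) (b : H)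
    (hb : b ∈ A.map (LinearMap.snd ℂ H H) ⊔
      (A.map (LinearMap.snd ℂ H H))ᗮ.comap (W : H →ₗ[ℂ] H))
    (x₀ : H)
    (hx₀ : ∃ z : H, (x₀, z) ∈ A ∧
      ∀ y ∈ A.map (LinearMap.snd ℂ H H), ‖R (z - b)‖ ≤ ‖R (y - b)‖) :
    ∀ x₁ : H,
      (∃ z : H, (x₁, z) ∈ A ∧
          ∀ y ∈ A.map (LinearMap.snd ℂ H H), ‖R (z - b)‖ ≤ ‖R (y - b)‖) ↔
      (∃ y : H, (x₁ - x₀, y) ∈ A ∧ W y = 0) := by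
  have mem_ran {u v : H} (h : (u, v) ∈ A) : v ∈ A.map (LinearMap.snd ℂ H H) := ⟨(u, v), h, rfl⟩
  obtain ⟨z₀, hz₀A, hz₀⟩ := hx₀
  intro x₁
  constructor
  · rintro ⟨z, hzA, hz⟩
    refine ⟨z - z₀, A.sub_mem hzA hz₀A, ?_⟩
    have hRz := map_eq_of_forall_norm_le _ R (mem_ran hzA) (mem_ran hz₀A) hz hz₀
    simp [← hR2, hRz]
  · rintro ⟨y, hyA, hy⟩
    have hRy : R y = 0 := apply_eq_zero_of_isSymmetric_of_apply_apply_eq_zero hR.isSymmetric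
      (by simpa [← hR2] using hy)
    refine ⟨z₀ + y, by simpa using A.add_mem hz₀A hyA, fun w hw => ?_⟩
    have hshift : R (z₀ + y - b) = R (z₀ - b) := by simp [hRy]
    exact hshift ▸ hz₀ w hw
end
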